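/- Let F_q be a finite field with q elements. Then the proportion of matrices A in GL(n,q) whose characteristic polynomial equals the minimal polynomial (cyclic matrices), i.e. the number of such invertible n×n matrices over F_q divided by |GL(n,q)|, converges as n → ∞ to (1 − q^{−5})/(1 + q^{−3}). -/

import Mathlib

open Polynomial Module

theorem exists_cyclic_vec {F V : Type*} [Field F] [AddCommGroup V] [Module F V]
    [FiniteDimensional F V] (T : Module.End F V) :
    ∃ v : V, ∀ g : F[X], aeval T g v = 0 → minpoly F T ∣ g := by
  obtain ⟨x, hx⟩ := exists_ker_toSpanSingleton_eq_annihilator F[X] (AEval' T)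
  obtain ⟨v, rfl⟩ := (AEval'.of T).surjective x
  refine ⟨v, fun g hg => ?_⟩
  rw [← span_minpoly_eq_annihilator] at hx
  rw [← Ideal.mem_span_singleton, ← hx, LinearMap.mem_ker, LinearMap.toSpanSingleton_apply]
  have := AEval.of_aeval_smul (R := F) (M := V) T g v
  rw [show (aeval T g • v) = aeval T g v from rfl, hg, map_zero] at this
  exact this.symm

theorem aeval_mulLeft_root {F : Type*} [Field F] (f g : F[X]) (x : AdjoinRoot f) :
    aeval (Algebra.lmul F (AdjoinRoot f) (AdjoinRoot.root f)) g x = AdjoinRoot.mk f g * x := by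
  rw [aeval_algHom_apply, AdjoinRoot.aeval_eq]
  rfl

theorem charpoly_eq_of_minpoly {F : Type*} [Field F] {n : ℕ} {f : F[X]} (hn : f.natDegree = n)
    (T : Module.End F (Fin n → F)) (h : minpoly F T = f) : T.charpoly = f := by
  have hi : IsIntegral F T := Algebra.IsIntegral.isIntegral T
  have h1 : minpoly F T ∣ T.charpoly := minpoly.dvd F T (LinearMap.aeval_self_charpoly T)
  have h2 := eq_of_monic_of_dvd_of_natDegree_le (minpoly.monic hi) (LinearMap.charpoly_monic T) h1
    (by rw [h, hn, LinearMap.charpoly_natDegree]; simp)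
  rw [← h, h2]

theorem exists_equiv_of_minpoly {F : Type*} [Field F] {n : ℕ} {f : F[X]} (hf : f.Monic)
    (hn : f.natDegree = n) (T : Module.End F (Fin n → F)) (h : minpoly F T = f) :
    ∃ e : AdjoinRoot f ≃ₗ[F] (Fin n → F), e.conj (Algebra.lmul F _ (AdjoinRoot.root f)) = T := by
  obtain ⟨v, hv⟩ := exists_cyclic_vec T
  have hfT : aeval T f = 0 := by rw [← h]; exact minpoly.aeval F T
  let φ : AdjoinRoot f →ₐ[F] Module.End F (Fin n → F) :=
    Ideal.Quotient.liftₐ (Ideal.span {f}) (aeval T) (fun a ha => by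
      obtain ⟨c, rfl⟩ := Ideal.mem_span_singleton.1 ha
      rw [map_mul, hfT, zero_mul])
  have hφ : ∀ g, φ (AdjoinRoot.mk f g) = aeval T g := fun g => rfl
  let ψ : AdjoinRoot f →ₗ[F] (Fin n → F) := (LinearMap.applyₗ v) ∘ₗ φ.toLinearMap
  have hψ : ∀ x, ψ x = φ x v := fun x => rfl
  have inj : Function.Injective ψ := by
    rw [injective_iff_map_eq_zero]
    intro x hx
    obtain ⟨g, rfl⟩ := AdjoinRoot.mk_surjective x
    rw [hψ, hφ] at hx
    rw [AdjoinRoot.mk_eq_zero, ← h]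
    exact hv g hx
  have : Module.Finite F (AdjoinRoot f) := hf.finite_adjoinRoot
  have hd : finrank F (AdjoinRoot f) = finrank F (Fin n → F) := by
    rw [(AdjoinRoot.powerBasis' hf).finrank]; simp [hn]
  let e := LinearEquiv.ofInjectiveOfFinrankEq ψ inj hd
  have he : ∀ x, e x = ψ x := fun x => rfl
  refine ⟨e, ?_⟩
  refine LinearMap.ext fun w => ?_
  obtain ⟨x, rfl⟩ := e.surjective w
  simp only [LinearEquiv.conj_apply_apply, LinearEquiv.symm_apply_apply]
  show e (AdjoinRoot.root f * x) = T (e x)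
  rw [he, he, hψ, hψ, map_mul]
  have : φ (AdjoinRoot.root f) = T := by rw [← AdjoinRoot.mk_X, hφ, aeval_X]
  rw [this]; rfl

theorem minpoly_conj {F : Type*} [Field F] {n : ℕ} {f : F[X]} (hf : f.Monic)
    (e : AdjoinRoot f ≃ₗ[F] (Fin n → F)) :
    minpoly F (e.conj (Algebra.lmul F _ (AdjoinRoot.root f))) = f := by
  have h1 := minpoly.algEquiv_eq (e.conjAlgEquiv F) (Algebra.lmul F _ (AdjoinRoot.root f))
  rw [show e.conj (Algebra.lmul F _ (AdjoinRoot.root f)) =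
    e.conjAlgEquiv F (Algebra.lmul F _ (AdjoinRoot.root f)) from rfl, h1,
    minpoly.algHom_eq _ (Algebra.lmul_injective), AdjoinRoot.minpoly_root hf.ne_zero]
  simp [hf.leadingCoeff]

theorem fiber_equiv {F : Type*} [Field F] {n : ℕ} {f : F[X]}
    (T : Module.End F (Fin n → F))
    (e₀ : AdjoinRoot f ≃ₗ[F] (Fin n → F)) (h₀ : e₀.conj (Algebra.lmul F _ (AdjoinRoot.root f)) = T) :
    Nonempty ({e : AdjoinRoot f ≃ₗ[F] (Fin n → F) //
      e.conj (Algebra.lmul F _ (AdjoinRoot.root f)) = T} ≃ (AdjoinRoot f)ˣ) := by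
  have key : ∀ e : AdjoinRoot f ≃ₗ[F] (Fin n → F),
      e.conj (Algebra.lmul F _ (AdjoinRoot.root f)) = T ↔
        ∀ x, e (AdjoinRoot.root f * x) = T (e x) := by
    intro e
    constructor
    · rintro rfl x
      simp [LinearEquiv.conj_apply_apply]
    · intro h
      refine LinearMap.ext fun w => ?_
      obtain ⟨x, rfl⟩ := e.surjective w
      simpa [LinearEquiv.conj_apply_apply] using h x
  have key2 : ∀ e : AdjoinRoot f ≃ₗ[F] (Fin n → F),
      (∀ x, e (AdjoinRoot.root f * x) = T (e x)) → ∀ g x, e (AdjoinRoot.mk f g * x) = aeval T g (e x) := by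
    intro e he g
    induction g using Polynomial.induction_on' with
    | add p q hp hq => intro x; simp [add_mul, hp, hq]
    | monomial k a =>
      intro x
      rw [← C_mul_X_pow_eq_monomial]
      have : ∀ k x, e (AdjoinRoot.root f ^ k * x) = (T ^ k) (e x) := by
        intro k
        induction k with
        | zero => simp
        | succ k ih => intro x; rw [pow_succ, mul_assoc, ih, he, pow_succ]; rfl
      simp only [map_mul, AdjoinRoot.mk_C, map_pow, AdjoinRoot.mk_X, aeval_C, aeval_X, mul_assoc]
      rw [← AdjoinRoot.algebraMap_eq, ← Algebra.smul_def, map_smul, this]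
      simp [Module.algebraMap_end_apply]
  have key3 : ∀ e e' : AdjoinRoot f ≃ₗ[F] (Fin n → F),
      (∀ x, e (AdjoinRoot.root f * x) = T (e x)) → (∀ x, e' (AdjoinRoot.root f * x) = T (e' x)) →
      ∀ x y, e.symm (e' (x * y)) = x * e.symm (e' y) := by
    intro e e' h h' x y
    obtain ⟨g, rfl⟩ := AdjoinRoot.mk_surjective x
    rw [key2 e' h', LinearEquiv.symm_apply_eq, key2 e h]
    simp
  have H₀ := (key e₀).1 h₀
  refine ⟨⟨fun e => ⟨e₀.symm (e.1 1), e.1.symm (e₀ 1), ?_, ?_⟩, fun u => ⟨(LinearEquiv.smulOfUnit u).restrictScalars F |>.trans e₀, ?_⟩, ?_, ?_⟩⟩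
  · have := key3 e.1 e₀ ((key _).1 e.2) H₀ (e₀.symm (e.1 1)) 1
    simpa using this.symm
  · have := key3 e₀ e.1 H₀ ((key _).1 e.2) (e.1.symm (e₀ 1)) 1
    simpa using this.symm
  · rw [key]
    intro x
    show e₀ ((u : AdjoinRoot f) * (_ * x)) = T (e₀ ((u : AdjoinRoot f) * x))
    rw [← H₀]; congr 1; ring
  · intro e
    ext1
    ext1 x
    show e₀ (e₀.symm (e.1 1) * x) = e.1 x
    rw [← LinearEquiv.eq_symm_apply, mul_comm, ← key3 e₀ e.1 H₀ ((key _).1 e.2), mul_one]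
  · intro u
    ext
    show e₀.symm (e₀ ((u : AdjoinRoot f) * 1)) = u
    simp

theorem card_fiber {F : Type*} [Field F] {n : ℕ} {f : F[X]} (hf : f.Monic)
    (hn : f.natDegree = n) :
    Nat.card {A : Matrix (Fin n) (Fin n) F // A.charpoly = minpoly F A ∧ A.charpoly = f}
      * Nat.card (AdjoinRoot f)ˣ = Nat.card {A : Matrix (Fin n) (Fin n) F // IsUnit A} := by
  have e0 : {A : Matrix (Fin n) (Fin n) F // A.charpoly = minpoly F A ∧ A.charpoly = f} ≃
      {T : Module.End F (Fin n → F) // minpoly F T = f} :=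
    (Matrix.toLin' (R := F)).toEquiv.subtypeEquiv (fun A => by
      show _ ↔ minpoly F (Matrix.toLin' A) = f
      rw [Matrix.minpoly_toLin']
      constructor
      · rintro ⟨h1, h2⟩; rw [← h1, h2]
      · intro h
        have := charpoly_eq_of_minpoly hn (Matrix.toLin' A) (by rwa [Matrix.minpoly_toLin'])
        rw [Matrix.charpoly_toLin'] at this
        exact ⟨by rw [this, h], this⟩)
  have : Module.Finite F (AdjoinRoot f) := hf.finite_adjoinRoot
  have hd : finrank F (AdjoinRoot f) = finrank F (Fin n → F) := by
    rw [(AdjoinRoot.powerBasis' hf).finrank]; simp [hn]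
  let b : AdjoinRoot f ≃ₗ[F] (Fin n → F) := LinearEquiv.ofFinrankEq _ _ hd
  let π : (AdjoinRoot f ≃ₗ[F] (Fin n → F)) → {T : Module.End F (Fin n → F) // minpoly F T = f} :=
    fun e => ⟨e.conj (Algebra.lmul F _ (AdjoinRoot.root f)), minpoly_conj hf e⟩
  have e1 : ∀ T, Nonempty ({e // π e = T} ≃ (AdjoinRoot f)ˣ) := by
    rintro ⟨T, hT⟩
    obtain ⟨e₀, h₀⟩ := exists_equiv_of_minpoly hf hn T hT
    obtain ⟨E⟩ := fiber_equiv T e₀ h₀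
    exact ⟨(Equiv.subtypeEquivRight (fun e => by simp [π, Subtype.ext_iff])).trans E⟩
  have e2 : (AdjoinRoot f ≃ₗ[F] (Fin n → F)) ≃
      {T : Module.End F (Fin n → F) // minpoly F T = f} × (AdjoinRoot f)ˣ :=
    (Equiv.sigmaFiberEquiv π).symm.trans
      ((Equiv.sigmaCongrRight fun T => (e1 T).some).trans (Equiv.sigmaEquivProd _ _))
  have e3 : (AdjoinRoot f ≃ₗ[F] (Fin n → F)) ≃ ((Fin n → F) ≃ₗ[F] (Fin n → F)) :=
    ⟨fun e => b.symm.trans e, fun e => b.trans e, fun e => by ext; simp, fun e => by ext; simp⟩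
  have e4 : ((Fin n → F) ≃ₗ[F] (Fin n → F)) ≃ {A : Matrix (Fin n) (Fin n) F // IsUnit A} :=
    (LinearMap.GeneralLinearGroup.generalLinearEquiv F (Fin n → F)).symm.toEquiv.trans
      ((Units.mapEquiv (LinearMap.toMatrixAlgEquiv' (R := F) (n := Fin n)).toMulEquiv).toEquiv.trans
        ⟨fun u => ⟨u, u.isUnit⟩, fun u => u.2.unit, fun u => by ext; rfl, fun u => by ext; rfl⟩)
  rw [Nat.card_congr e0, ← Nat.card_prod, ← Nat.card_congr e2, Nat.card_congr e3, Nat.card_congr e4]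

section counting
variable {F : Type} [Field F]

/-- Monic irreducible polynomials. -/
abbrev MonicIrr (F : Type) [Field F] := {p : F[X] // p.Monic ∧ Irreducible p}

theorem prod_monic (s : Finset (MonicIrr F)) : (∏ p ∈ s, p.1).Monic :=
  monic_prod_of_monic _ _ fun p _ => p.2.1

theorem prod_natDegree (s : Finset (MonicIrr F)) :
    (∏ p ∈ s, p.1).natDegree = ∑ p ∈ s, p.1.natDegree :=
  natDegree_prod_of_monic _ _ fun p _ => p.2.1

theorem monicIrr_coprime {p r : MonicIrr F} (h : p ≠ r) : IsCoprime p.1 r.1 := by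
  rw [p.2.2.coprime_iff_not_dvd]
  intro hd
  apply h
  exact Subtype.ext (eq_of_monic_of_associated p.2.1 r.2.1 (p.2.2.associated_of_dvd r.2.2 hd))

theorem primeProd_dvd_iff (s : Finset (MonicIrr F)) (f : F[X]) :
    (∏ p ∈ s, p.1) ∣ f ↔ ∀ p ∈ s, p.1 ∣ f := by
  constructor
  · intro h p hp
    exact (Finset.dvd_prod_of_mem (fun p : MonicIrr F => p.1) hp).trans h
  · intro h
    exact Finset.prod_dvd_of_coprime (fun p _ r _ hpr => monicIrr_coprime hpr) h

variable [Fintype F]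

theorem finite_degreeLT (n : ℕ) : Finite (degreeLT F n) :=
  Finite.of_equiv _ (degreeLTEquiv F n).toEquiv.symm

theorem card_degreeLT (n : ℕ) : Nat.card (degreeLT F n) = Fintype.card F ^ n := by
  rw [Nat.card_congr (degreeLTEquiv F n).toEquiv]; simp

theorem finite_lt (n : ℕ) : {g : F[X] | g.degree < n}.Finite := by
  have := finite_degreeLT (F := F) n
  refine (Set.toFinite (degreeLT F n : Set F[X])).subset ?_
  intro g hg
  simpa [mem_degreeLT] using hg

/-- polynomials of degree less than `n`. -/
noncomputable def ltFS (F : Type) [Field F] [Fintype F] (n : ℕ) : Finset F[X] :=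
  (finite_lt (F := F) n).toFinset

theorem mem_ltFS {n : ℕ} {g : F[X]} : g ∈ ltFS F n ↔ g.degree < n := by simp [ltFS]

theorem card_ltFS (n : ℕ) : (ltFS F n).card = Fintype.card F ^ n := by
  rw [← card_degreeLT, ← Fintype.card_coe, ← Nat.card_eq_fintype_card]
  exact Nat.card_congr (Equiv.subtypeEquivRight fun g => by rw [mem_ltFS, mem_degreeLT])

theorem finite_monic (n : ℕ) : {g : F[X] | g.Monic ∧ g.natDegree = n}.Finite := by
  have := finite_degreeLT (F := F) n
  have h : Finite {g : F[X] | g.Monic ∧ g.natDegree = n} :=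
    Finite.of_equiv _ (monicEquivDegreeLT (R := F) n).symm
  exact Set.toFinite _

/-- monic polynomials of degree `n`. -/
noncomputable def monFS (F : Type) [Field F] [Fintype F] (n : ℕ) : Finset F[X] :=
  (finite_monic (F := F) n).toFinset

theorem mem_monFS {n : ℕ} {g : F[X]} : g ∈ monFS F n ↔ g.Monic ∧ g.natDegree = n := by
  simp [monFS]

theorem card_monFS (n : ℕ) : (monFS F n).card = Fintype.card F ^ n := by
  rw [← card_degreeLT, ← Fintype.card_coe, ← Nat.card_eq_fintype_card]
  exact Nat.card_congr
    ((Equiv.subtypeEquivRight fun g => by rw [mem_monFS]).trans (monicEquivDegreeLT (R := F) n))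

open Classical in
theorem card_monFS_dvd {n : ℕ} {D : F[X]} (hD : D.Monic) (h : D.natDegree ≤ n) :
    ((monFS F n).filter (D ∣ ·)).card = Fintype.card F ^ (n - D.natDegree) := by
  rw [← card_monFS]
  symm
  refine Finset.card_bij (fun g _ => D * g) ?_ ?_ ?_
  · intro g hg
    rw [mem_monFS] at hg
    rw [Finset.mem_filter, mem_monFS, hD.natDegree_mul hg.1]
    exact ⟨⟨hD.mul hg.1, by omega⟩, dvd_mul_right _ _⟩
  · intro a _ b _ hab
    exact mul_left_cancel₀ hD.ne_zero hab
  · intro f hf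
    rw [Finset.mem_filter, mem_monFS] at hf
    obtain ⟨⟨hm, hn⟩, g, rfl⟩ := hf
    have hg : g.Monic := hD.of_mul_monic_left hm
    rw [hD.natDegree_mul hg] at hn
    exact ⟨g, mem_monFS.2 ⟨hg, by omega⟩, rfl⟩

open Classical in
theorem card_ltFS_dvd {n : ℕ} {D : F[X]} (hD : D.Monic) (h : D.natDegree ≤ n) :
    ((ltFS F n).filter (D ∣ ·)).card = Fintype.card F ^ (n - D.natDegree) := by
  rw [← card_ltFS]
  symm
  have key : ∀ g : F[X], (D * g).degree < n ↔ g.degree < (n - D.natDegree : ℕ) := by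
    intro g
    by_cases hg : g = 0
    · simp [hg]
    · have : D * g ≠ 0 := mul_ne_zero hD.ne_zero hg
      rw [← natDegree_lt_iff_degree_lt this, ← natDegree_lt_iff_degree_lt hg,
        natDegree_mul hD.ne_zero hg]
      omega
  refine Finset.card_bij (fun g _ => D * g) ?_ ?_ ?_
  · intro g hg
    rw [mem_ltFS] at hg
    rw [Finset.mem_filter, mem_ltFS, key]
    exact ⟨hg, dvd_mul_right _ _⟩
  · intro a _ b _ hab
    exact mul_left_cancel₀ hD.ne_zero hab
  · intro f hf
    rw [Finset.mem_filter, mem_ltFS] at hf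
    obtain ⟨hn, g, rfl⟩ := hf
    exact ⟨g, mem_ltFS.2 ((key g).1 hn), rfl⟩

theorem finite_irr_le (n : ℕ) : {p : MonicIrr F | p.1.natDegree ≤ n}.Finite := by
  refine Set.Finite.of_finite_image (f := Subtype.val) ?_ Subtype.val_injective.injOn
  refine (finite_lt (F := F) (n+1)).subset ?_
  rintro _ ⟨p, hp, rfl⟩
  simp only [Set.mem_ofPred_eq] at hp ⊢
  rw [← natDegree_lt_iff_degree_lt p.2.1.ne_zero]
  omega

theorem finite_pf {f : F[X]} (hf : f ≠ 0) : {p : MonicIrr F | p.1 ∣ f}.Finite :=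
  (finite_irr_le f.natDegree).subset fun _ hp => natDegree_le_of_dvd hp hf

open Classical in
/-- monic prime divisors -/
noncomputable def pf (f : F[X]) : Finset (MonicIrr F) :=
  if hf : f ≠ 0 then (finite_pf hf).toFinset else ∅

theorem mem_pf {f : F[X]} (hf : f ≠ 0) {p : MonicIrr F} : p ∈ pf f ↔ p.1 ∣ f := by
  simp [pf, hf]

theorem finite_sets (n : ℕ) :
    {s : Finset (MonicIrr F) | ∑ p ∈ s, p.1.natDegree ≤ n}.Finite := by
  refine ((finite_irr_le (F := F) n).toFinset.powerset.finite_toSet).subset ?_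
  intro s hs
  simp only [Set.mem_ofPred_eq, Finset.coe_powerset, Set.mem_preimage, Set.mem_powerset_iff] at hs ⊢
  intro p hp
  simp only [Set.Finite.coe_toFinset, Set.mem_ofPred_eq]
  exact (Finset.single_le_sum (f := fun p : MonicIrr F => p.1.natDegree)
    (fun _ _ => Nat.zero_le _) hp).trans hs

/-- sets of primes of total degree at most `n` -/
noncomputable def setsFS (F : Type) [Field F] [Fintype F] (n : ℕ) : Finset (Finset (MonicIrr F)) :=
  (finite_sets (F := F) n).toFinset

theorem mem_setsFS {n : ℕ} {s : Finset (MonicIrr F)} :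
    s ∈ setsFS F n ↔ ∑ p ∈ s, p.1.natDegree ≤ n := by simp [setsFS]

/-- The main counting identity. -/
theorem sum_mult (w : MonicIrr F → ℝ) (n : ℕ) :
    ((Fintype.card F : ℝ) ^ n)⁻¹ * ∑ f ∈ monFS F n, ∏ p ∈ pf f, (1 + w p) =
      ∑ s ∈ setsFS F n, ∏ p ∈ s, w p / (Fintype.card F : ℝ) ^ p.1.natDegree := by
  classical
  have hq : (Fintype.card F : ℝ) ≠ 0 := by simp
  simp_rw [Finset.prod_one_add]
  rw [Finset.sum_comm' (t' := setsFS F n)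
    (s' := fun s => (monFS F n).filter ((∏ p ∈ s, p.1) ∣ ·)), Finset.mul_sum]
  · refine Finset.sum_congr rfl fun s hs => ?_
    rw [mem_setsFS, ← prod_natDegree] at hs
    rw [Finset.sum_const, card_monFS_dvd (prod_monic s) hs, Finset.prod_div_distrib,
      Finset.prod_pow_eq_pow_sum, ← prod_natDegree, nsmul_eq_mul]
    push_cast
    rw [pow_sub₀ _ hq hs]
    field_simp
  · intro f s
    simp only [Finset.mem_powerset, Finset.mem_filter]
    constructor
    · rintro ⟨h1, h2⟩
      have hf := mem_monFS.1 h1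
      have hd : (∏ p ∈ s, p.1) ∣ f :=
        (primeProd_dvd_iff s f).2 fun p hp => (mem_pf hf.1.ne_zero).1 (h2 hp)
      refine ⟨⟨h1, hd⟩, ?_⟩
      rw [mem_setsFS, ← prod_natDegree, ← hf.2]
      exact natDegree_le_of_dvd hd hf.1.ne_zero
    · rintro ⟨⟨h1, h2⟩, _⟩
      have hf := mem_monFS.1 h1
      exact ⟨h1, fun p hp => (mem_pf hf.1.ne_zero).2 ((primeProd_dvd_iff s f).1 h2 p hp)⟩

theorem coprime_iff_pf {f g : F[X]} (hf : f ≠ 0) :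
    IsCoprime f g ↔ ∀ p ∈ pf f, ¬ p.1 ∣ g := by
  classical
  constructor
  · intro h p hp hg
    exact p.2.2.not_isUnit (h.isUnit_of_dvd' ((mem_pf hf).1 hp) hg)
  · intro h
    refine isCoprime_of_irreducible_dvd (fun h0 => hf h0.1) ?_
    intro z hz hzf hzg
    have ha : Associated (normalize z) z := normalize_associated z
    exact h ⟨normalize z, Polynomial.monic_normalize hz.ne_zero, ha.symm.irreducible hz⟩
      ((mem_pf hf).2 (ha.dvd.trans hzf)) (ha.dvd.trans hzg)

theorem card_coprime {f : F[X]} {n : ℕ} (hf : f.Monic) (hn : f.natDegree = n) [DecidablePred (IsCoprime f)] :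
    (((ltFS F n).filter (IsCoprime f)).card : ℝ) = (Fintype.card F : ℝ) ^ n *
      ∏ p ∈ pf f, (1 - 1 / (Fintype.card F : ℝ) ^ p.1.natDegree) := by
  classical
  have hq : (Fintype.card F : ℝ) ≠ 0 := by simp
  have h1 : (((ltFS F n).filter (IsCoprime f)).card : ℝ) =
      ∑ g ∈ ltFS F n, ∏ p ∈ pf f, (1 + if p.1 ∣ g then (-1 : ℝ) else 0) := by
    rw [Finset.card_filter]
    push_cast
    refine Finset.sum_congr rfl fun g _ => ?_
    split_ifs with h <;> rw [coprime_iff_pf hf.ne_zero] at h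
    · symm
      refine Finset.prod_eq_one fun p hp => ?_
      simp [h p hp]
    · push Not at h
      obtain ⟨p, hp, hpg⟩ := h
      symm
      exact Finset.prod_eq_zero hp (by simp [hpg])
  rw [h1]
  simp_rw [sub_eq_add_neg, Finset.prod_one_add]
  rw [Finset.sum_comm, Finset.mul_sum]
  refine Finset.sum_congr rfl fun s hs => ?_
  have hd : (∏ p ∈ s, p.1) ∣ f :=
    (primeProd_dvd_iff s f).2 fun p hp => (mem_pf hf.ne_zero).1 (Finset.mem_powerset.1 hs hp)
  have hle : (∏ p ∈ s, p.1).natDegree ≤ n := hn ▸ natDegree_le_of_dvd hd hf.ne_zero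
  have h2 : ∀ g : F[X], (∏ p ∈ s, if p.1 ∣ g then (-1 : ℝ) else 0) =
      if (∏ p ∈ s, p.1) ∣ g then (-1) ^ s.card else 0 := by
    intro g
    split_ifs with h
    · rw [primeProd_dvd_iff] at h
      rw [Finset.prod_congr rfl (fun p hp => if_pos (h p hp)), Finset.prod_const]
    · rw [primeProd_dvd_iff] at h
      push Not at h
      obtain ⟨p, hp, hpg⟩ := h
      exact Finset.prod_eq_zero hp (by simp [hpg])
  simp_rw [h2]
  rw [← Finset.sum_filter, Finset.sum_const, card_ltFS_dvd (prod_monic s) hle, nsmul_eq_mul,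
    Finset.prod_neg, Finset.prod_div_distrib, Finset.prod_pow_eq_pow_sum, ← prod_natDegree]
  push_cast
  rw [pow_sub₀ _ hq hle]
  simp
  ring

theorem isUnit_mk_iff (f g : F[X]) : IsUnit (AdjoinRoot.mk f g) ↔ IsCoprime f g := by
  rw [isUnit_iff_exists_inv]
  constructor
  · rintro ⟨b, hb⟩
    obtain ⟨h, rfl⟩ := AdjoinRoot.mk_surjective b
    rw [← map_mul, ← map_one (AdjoinRoot.mk f), AdjoinRoot.mk_eq_mk] at hb
    obtain ⟨c, hc⟩ := hb
    exact ⟨-c, h, by linear_combination hc⟩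
  · rintro ⟨a, b, hab⟩
    refine ⟨AdjoinRoot.mk f b, ?_⟩
    rw [← map_mul, ← map_one (AdjoinRoot.mk f), AdjoinRoot.mk_eq_mk]
    exact ⟨-a, by linear_combination hab⟩

theorem card_units {f : F[X]} {n : ℕ} (hf : f.Monic) (hn : f.natDegree = n) :
    (Nat.card (AdjoinRoot f)ˣ : ℝ) = (Fintype.card F : ℝ) ^ n *
      ∏ p ∈ pf f, (1 - 1 / (Fintype.card F : ℝ) ^ p.1.natDegree) := by
  classical
  rw [← card_coprime hf hn]
  norm_cast
  have hdeg : f.degree = n := by rw [degree_eq_natDegree hf.ne_zero, hn]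
  let φ : (ltFS F n).filter (IsCoprime f) → (AdjoinRoot f)ˣ := fun g =>
    ((isUnit_mk_iff f g.1).2 (Finset.mem_filter.1 g.2).2).unit
  have hφ : ∀ g, ((φ g : (AdjoinRoot f)ˣ) : AdjoinRoot f) = AdjoinRoot.mk f g.1 := fun g => rfl
  have hb : Function.Bijective φ := by
    constructor
    · rintro ⟨a, ha⟩ ⟨b, hb⟩ hab
      have := congrArg Units.val hab
      rw [hφ, hφ, AdjoinRoot.mk_eq_mk] at this
      simp only [Finset.mem_filter, mem_ltFS] at ha hb
      have h0 := eq_zero_of_dvd_of_degree_lt this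
        (lt_of_le_of_lt (degree_sub_le _ _) (max_lt (hdeg ▸ ha.1) (hdeg ▸ hb.1)))
      exact Subtype.ext (sub_eq_zero.1 h0)
    · intro u
      obtain ⟨g, hg⟩ := AdjoinRoot.mk_surjective (u : AdjoinRoot f)
      have h1 : AdjoinRoot.mk f (g %ₘ f) = u := by
        rw [← hg, AdjoinRoot.mk_eq_mk]
        exact ⟨-(g /ₘ f), by linear_combination modByMonic_add_div g f⟩
      refine ⟨⟨g %ₘ f, ?_⟩, Units.ext h1⟩
      rw [Finset.mem_filter, mem_ltFS, ← isUnit_mk_iff, h1]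
      exact ⟨hdeg ▸ degree_modByMonic_lt g hf, u.isUnit⟩
  rw [← Nat.card_congr (Equiv.ofBijective φ hb), Nat.card_eq_fintype_card, Fintype.card_coe]
end counting
section analytic
variable {F : Type} [Field F] [Fintype F]


theorem irr_deg_pos (p : MonicIrr F) : 0 < p.1.natDegree := p.2.2.natDegree_pos

theorem two_le_q : (2 : ℝ) ≤ (Fintype.card F : ℝ) := by
  exact_mod_cast Fintype.one_lt_card (α := F)

theorem two_le_norm (p : MonicIrr F) : (2 : ℝ) ≤ (Fintype.card F : ℝ) ^ p.1.natDegree :=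
  (two_le_q (F := F)).trans (le_self_pow₀ (by linarith [two_le_q (F := F)]) (irr_deg_pos p).ne')

theorem summable_irr : Summable (fun p : MonicIrr F => (((Fintype.card F : ℝ)⁻¹ ^ p.1.natDegree)) ^ 2) := by
  classical
  have hq := two_le_q (F := F)
  set x : ℝ := (Fintype.card F : ℝ)⁻¹ with hx
  have hx0 : 0 < x := by positivity
  have hx1 : x < 1 := inv_lt_one_of_one_lt₀ (by linarith)
  have hgeo : Summable (fun n : ℕ => x ^ n) := summable_geometric_of_lt_one hx0.le hx1
  refine summable_of_sum_le (c := ∑' n : ℕ, x ^ n) (fun p => by positivity) fun u => ?_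
  have hmaps : ∀ p ∈ u, p.1.natDegree ∈ Finset.image (fun p : MonicIrr F => p.1.natDegree) u :=
    fun p hp => Finset.mem_image_of_mem _ hp
  rw [← Finset.sum_fiberwise_of_maps_to hmaps]
  refine le_trans (Finset.sum_le_sum fun n _ => ?_) (hgeo.sum_le_tsum _ fun n _ => by positivity)
  have h1 : (u.filter fun p => p.1.natDegree = n).card ≤ (monFS F n).card := by
    refine Finset.card_le_card_of_injOn Subtype.val ?_ Subtype.val_injective.injOn
    intro p hp
    have hp' := (Finset.mem_filter.1 (Finset.mem_coe.1 hp)).2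
    exact Finset.mem_coe.2 (mem_monFS.2 ⟨p.2.1, hp'⟩)
  rw [card_monFS] at h1
  rw [Finset.sum_congr rfl (g := fun _ => (x ^ n) ^ 2)
    (fun p hp => by rw [(Finset.mem_filter.1 hp).2]), Finset.sum_const, nsmul_eq_mul]
  have h2 : ((u.filter fun p => p.1.natDegree = n).card : ℝ) ≤ (Fintype.card F : ℝ) ^ n := by
    exact_mod_cast h1
  have h3 : (Fintype.card F : ℝ) ^ n * x ^ n = 1 := by
    rw [← mul_pow, hx, mul_inv_cancel₀ (by linarith), one_pow]
  calc _ ≤ (Fintype.card F : ℝ) ^ n * (x ^ n) ^ 2 := by gcongr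
    _ = x ^ n := by linear_combination (x ^ n) * h3

theorem tendsto_setsFS : Filter.Tendsto (setsFS F) Filter.atTop Filter.atTop := by
  refine Filter.tendsto_atTop_finset_of_monotone ?_ ?_
  · intro a b hab s hs
    rw [mem_setsFS] at *
    exact hs.trans hab
  · intro s
    exact ⟨_, mem_setsFS.2 le_rfl⟩

theorem exists_hasProd (a : MonicIrr F → ℝ) (C : ℝ)
    (h : ∀ p, |a p| ≤ C * (((Fintype.card F : ℝ)⁻¹ ^ p.1.natDegree)) ^ 2) :
    ∃ S : ℝ, HasProd (fun p => 1 + a p) S ∧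
      Filter.Tendsto (fun n => ∑ s ∈ setsFS F n, ∏ p ∈ s, a p) Filter.atTop (nhds S) := by
  have h1 : Summable (fun p => ‖a p‖) :=
    Summable.of_nonneg_of_le (fun p => norm_nonneg _) h (summable_irr.mul_left C)
  have h2 : Summable (fun s : Finset (MonicIrr F) => ∏ p ∈ s, a p) :=
    summable_finsetProd_of_summable_norm h1
  obtain ⟨S, hS⟩ := h2
  exact ⟨S, hasProd_one_add_of_hasSum_prod hS, hS.comp tendsto_setsFS⟩

theorem pf_nonempty {f : F[X]} (hf : f.Monic) (hd : 0 < f.natDegree) : (pf f).Nonempty := by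
  by_contra h
  rw [Finset.not_nonempty_iff_eq_empty] at h
  have h1 : IsCoprime f f := (coprime_iff_pf hf.ne_zero).2 (by simp [h])
  rw [isCoprime_self] at h1
  have := natDegree_eq_zero_of_isUnit h1
  omega

theorem sum_mobius (n : ℕ) :
    ∑ s ∈ setsFS F n, ∏ p ∈ s, (-1 : ℝ) / (Fintype.card F : ℝ) ^ p.1.natDegree =
      if n = 0 then 1 else 0 := by
  rw [← sum_mult (fun _ => (-1 : ℝ))]
  split_ifs with h
  · subst h
    have h1 : monFS F 0 = {1} := by
      ext f
      rw [mem_monFS, Finset.mem_singleton]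
      constructor
      · rintro ⟨h1, h2⟩; exact h1.natDegree_eq_zero.1 h2
      · rintro rfl; simp
    have h2 : pf (1 : F[X]) = ∅ := by
      ext p
      rw [mem_pf one_ne_zero]
      simpa using fun h => p.2.2.not_isUnit (isUnit_of_dvd_one h)
    simp [h1, h2]
  · rw [Finset.sum_eq_zero, mul_zero]
    intro f hf
    rw [mem_monFS] at hf
    obtain ⟨p, hp⟩ := pf_nonempty hf.1 (by omega)
    exact Finset.prod_eq_zero hp (by norm_num)

theorem hasProd_zeta (j : ℕ) (hj : 1 ≤ j) :
    HasProd (fun p : MonicIrr F => 1 - ((Fintype.card F : ℝ)⁻¹ ^ p.1.natDegree) ^ (j + 1))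
      (1 - (Fintype.card F : ℝ)⁻¹ ^ j) := by
  classical
  have hq := two_le_q (F := F)
  have hmob := sum_mobius (F := F)
  simp_rw [div_eq_mul_inv, ← inv_pow] at hmob
  set x : ℝ := (Fintype.card F : ℝ)⁻¹ with hx
  have hx0 : 0 < x := by positivity
  have hx1 : x < 1 := inv_lt_one_of_one_lt₀ (by linarith)
  obtain ⟨S, hS, hT⟩ := exists_hasProd
    (fun p : MonicIrr F => -(x ^ p.1.natDegree) ^ (j + 1)) 1 (fun p => by
      rw [abs_neg, abs_of_nonneg (by positivity), one_mul]
      exact pow_le_pow_of_le_one (by positivity) (pow_le_one₀ hx0.le hx1.le) (by omega))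
  have hsub : ∀ n, setsFS F n ⊆ setsFS F (n + 1) := fun n s hs => by
    rw [mem_setsFS] at *; omega
  have hstep : ∀ n, ∑ s ∈ setsFS F (n + 1) \ setsFS F n, ∏ p ∈ s, (-1 * x ^ p.1.natDegree) =
      if n = 0 then -1 else 0 := by
    intro n
    have := Finset.sum_sdiff (hsub n) (f := fun s => ∏ p ∈ s, (-1 * x ^ p.1.natDegree))
    rw [hmob, hmob] at this
    split_ifs at this ⊢ with h <;> simp_all
  have hstep' : ∀ n, ∑ s ∈ setsFS F (n + 1) \ setsFS F n, ∏ p ∈ s, -(x ^ p.1.natDegree) ^ (j + 1) =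
      x ^ (j * (n + 1)) * if n = 0 then -1 else 0 := by
    intro n
    rw [← hstep, Finset.mul_sum]
    refine Finset.sum_congr rfl fun s hs => ?_
    rw [Finset.mem_sdiff, mem_setsFS, mem_setsFS] at hs
    have hd : ∑ p ∈ s, p.1.natDegree = n + 1 := by omega
    rw [mul_comm j, pow_mul, ← hd, ← Finset.prod_pow_eq_pow_sum, ← Finset.prod_pow,
      ← Finset.prod_mul_distrib]
    exact Finset.prod_congr rfl fun p _ => by ring
  have h0 : setsFS F 0 = {∅} := by
    ext s
    rw [mem_setsFS, Finset.mem_singleton]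
    constructor
    · intro h
      rw [Finset.eq_empty_iff_forall_notMem]
      intro p hp
      have h1 : p.1.natDegree ≤ ∑ p ∈ s, p.1.natDegree :=
        Finset.single_le_sum (f := fun p : MonicIrr F => p.1.natDegree)
          (fun _ _ => Nat.zero_le _) hp
      have := irr_deg_pos p
      omega
    · rintro rfl; simp
  have hval : ∀ n, ∑ s ∈ setsFS F (n + 1), ∏ p ∈ s, -(x ^ p.1.natDegree) ^ (j + 1) = 1 - x ^ j := by
    intro n
    induction n with
    | zero =>
      rw [← Finset.sum_sdiff (hsub 0), hstep' 0, h0]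
      simp; ring
    | succ n ih =>
      rw [← Finset.sum_sdiff (hsub (n + 1)), hstep' (n + 1), ih]
      simp
  have hT' := (Filter.tendsto_add_atTop_iff_nat 1).2 hT
  simp_rw [hval] at hT'
  rw [tendsto_nhds_unique tendsto_const_nhds hT']
  simpa [sub_eq_add_neg] using hS

open Classical in
/-- The weights. -/
noncomputable def wt (p : MonicIrr F) : ℝ :=
  if p.1 = X then -1 else 1 / ((Fintype.card F : ℝ) ^ p.1.natDegree - 1)

theorem tendsto_wt :
    Filter.Tendsto (fun n => ∑ s ∈ setsFS F n,
      ∏ p ∈ s, wt p / (Fintype.card F : ℝ) ^ p.1.natDegree) Filter.atTop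
      (nhds ((1 - (Fintype.card F : ℝ)⁻¹ ^ 5) / (1 + (Fintype.card F : ℝ)⁻¹ ^ 3))) := by
  classical
  have hq := two_le_q (F := F)
  have hqx : (Fintype.card F : ℝ) * (Fintype.card F : ℝ)⁻¹ = 1 := mul_inv_cancel₀ (by linarith)
  obtain ⟨S, hS, hT⟩ := exists_hasProd
    (fun p : MonicIrr F => wt p / (Fintype.card F : ℝ) ^ p.1.natDegree) (Fintype.card F : ℝ) (by
      intro p
      have h2 := two_le_norm p
      rw [wt]
      split_ifs with h
      · rw [h, natDegree_X, pow_one, pow_one, abs_div, abs_neg, abs_one, abs_of_pos (by linarith)]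
        rw [pow_two, ← mul_assoc, hqx, one_mul, one_div]
      · rw [inv_pow]
        set P := (Fintype.card F : ℝ) ^ p.1.natDegree
        have : 0 < P - 1 := by linarith
        rw [abs_of_nonneg (by positivity), div_div, inv_pow, ← div_eq_mul_inv,
          div_le_div_iff₀ (by positivity) (by positivity)]
        nlinarith [mul_nonneg (by linarith : (0:ℝ) ≤ (Fintype.card F : ℝ) - 2)
          (mul_nonneg this.le (by linarith : 0 ≤ P))])
  have z2 := hasProd_zeta (F := F) 1 (by norm_num)
  have z3 := hasProd_zeta (F := F) 2 (by norm_num)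
  have z6 := hasProd_zeta (F := F) 5 (by norm_num)
  let pX : MonicIrr F := ⟨X, monic_X, irreducible_X⟩
  set x : ℝ := (Fintype.card F : ℝ)⁻¹ with hx
  have hx0 : 0 < x := by positivity
  have hx1 : x < 1 := inv_lt_one_of_one_lt₀ (by linarith)
  have hpow : ∀ k : ℕ, k ≠ 0 → x ^ k < 1 := fun k hk => pow_lt_one₀ hx0.le hx1 hk
  have hc := hasProd_ite_eq pX ((1 - x) * (1 - x ^ 2) * (1 - x ^ 3) / (1 - x ^ 6))
  have hL := (hS.mul z2).mul z3
  have hR := z6.mul hc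
  have hfun : (fun p : MonicIrr F => (1 + wt p / (Fintype.card F : ℝ) ^ p.1.natDegree) *
      (1 - (x ^ p.1.natDegree) ^ (1 + 1)) * (1 - (x ^ p.1.natDegree) ^ (2 + 1))) =
      fun p => (1 - (x ^ p.1.natDegree) ^ (5 + 1)) *
        (if p = pX then (1 - x) * (1 - x ^ 2) * (1 - x ^ 3) / (1 - x ^ 6) else 1) := by
    funext p
    by_cases h : p = pX
    · subst h
      have h6 : 1 - x ^ 6 ≠ 0 := by linarith [hpow 6 (by norm_num)] |> fun h : 0 < 1 - x ^ 6 => h.ne'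
      simp only [wt, pX, if_true, natDegree_X, pow_one]
      rw [neg_div, one_div, ← hx]
      field_simp
      ring
    · have h' : p.1 ≠ X := fun h1 => h (Subtype.ext h1)
      have h2 := two_le_norm p
      rw [if_neg h, wt, if_neg h', hx, inv_pow]
      set P := (Fintype.card F : ℝ) ^ p.1.natDegree
      have : P - 1 ≠ 0 := by linarith [h2] |> fun h : 0 < P - 1 => h.ne'
      have : P ≠ 0 := by linarith [h2] |> fun h : 0 < P => h.ne'
      simp only [Nat.reduceAdd, inv_pow]
      field_simp
      ring
  rw [hfun] at hL
  have heq := hL.unique hR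
  have hS' : S = (1 - x ^ 5) / (1 + x ^ 3) := by
    have a1 : 0 < 1 - x ^ 1 := by linarith [hpow 1 (by norm_num)]
    have a2 : 0 < 1 - x ^ 2 := by linarith [hpow 2 (by norm_num)]
    have a3 : 0 < 1 - x ^ 3 := by linarith [hpow 3 (by norm_num)]
    have a6 : 0 < 1 - x ^ 6 := by linarith [hpow 6 (by norm_num)]
    have b3 : 0 < 1 + x ^ 3 := by positivity
    rw [mul_div_assoc', eq_div_iff a6.ne'] at heq
    rw [eq_div_iff b3.ne']
    refine mul_right_cancel₀ (mul_pos (mul_pos a1 a2) a3).ne' ?_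
    linear_combination heq
  rw [← hS']
  exact hT

theorem prod_wt {f : F[X]} {n : ℕ} (hf : f.Monic) (hn : f.natDegree = n) (h0 : f.coeff 0 ≠ 0) :
    ((Fintype.card F : ℝ) ^ n)⁻¹ * ∏ p ∈ pf f, (1 + wt p) = (Nat.card (AdjoinRoot f)ˣ : ℝ)⁻¹ := by
  rw [card_units hf hn, mul_inv, ← Finset.prod_inv_distrib]
  congr 1
  refine Finset.prod_congr rfl fun p hp => ?_
  have hX : p.1 ≠ X := by
    intro h
    have := (mem_pf hf.ne_zero).1 hp
    rw [h, X_dvd_iff] at this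
    exact h0 this
  have h2 := two_le_norm p
  rw [wt, if_neg hX]
  set P := (Fintype.card F : ℝ) ^ p.1.natDegree
  have h3 : P - 1 ≠ 0 := by linarith [h2] |> fun h : 0 < P - 1 => h.ne'
  have h4 : P ≠ 0 := by linarith [h2] |> fun h : 0 < P => h.ne'
  have h5 : 1 - 1 / P = (P - 1) / P := by field_simp
  rw [h5, inv_div]
  field_simp
  ring

theorem prod_wt_zero {f : F[X]} (hf : f.Monic) (h0 : f.coeff 0 = 0) :
    ∏ p ∈ pf f, (1 + wt p) = 0 := by
  refine Finset.prod_eq_zero (i := ⟨X, monic_X, irreducible_X⟩) ?_ ?_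
  · rw [mem_pf hf.ne_zero]; exact X_dvd_iff.2 h0
  · simp [wt]

theorem isUnit_iff_charpoly {n : ℕ} (A : Matrix (Fin n) (Fin n) F) :
    IsUnit A ↔ A.charpoly.coeff 0 ≠ 0 := by
  rw [Matrix.isUnit_iff_isUnit_det, Matrix.det_eq_sign_charpoly_coeff, isUnit_iff_ne_zero]
  simp

theorem card_cyclic (n : ℕ) :
    (Nat.card {A : Matrix (Fin n) (Fin n) F // IsUnit A ∧ A.charpoly = minpoly F A} : ℝ) /
          (Nat.card {A : Matrix (Fin n) (Fin n) F // IsUnit A} : ℝ) =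
    ∑ s ∈ setsFS F n, ∏ p ∈ s, wt p / (Fintype.card F : ℝ) ^ p.1.natDegree := by
  classical
  rw [← sum_mult, Finset.mul_sum]
  have hG : (Nat.card {A : Matrix (Fin n) (Fin n) F // IsUnit A} : ℝ) ≠ 0 := by
    have : Nonempty {A : Matrix (Fin n) (Fin n) F // IsUnit A} := ⟨⟨1, isUnit_one⟩⟩
    exact_mod_cast Nat.card_pos.ne'
  rw [Nat.card_eq_fintype_card (α := {A : Matrix (Fin n) (Fin n) F //
    IsUnit A ∧ A.charpoly = minpoly F A}), Fintype.card_subtype,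
    Finset.card_eq_sum_card_fiberwise (f := fun A => A.charpoly) (t := monFS F n) (by
      intro A _
      exact Finset.mem_coe.2 (mem_monFS.2 ⟨A.charpoly_monic, by simp⟩))]
  push_cast
  rw [Finset.sum_div]
  refine Finset.sum_congr rfl fun f hf => ?_
  rw [mem_monFS] at hf
  rw [Finset.filter_filter, ← Fintype.card_subtype, ← Nat.card_eq_fintype_card]
  by_cases h0 : f.coeff 0 = 0
  · rw [prod_wt_zero hf.1 h0, mul_zero]
    have : IsEmpty {A : Matrix (Fin n) (Fin n) F //
        (IsUnit A ∧ A.charpoly = minpoly F A) ∧ A.charpoly = f} := by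
      refine ⟨fun A => ?_⟩
      obtain ⟨A, ⟨h1, _⟩, h2⟩ := A
      rw [isUnit_iff_charpoly, h2] at h1
      exact h1 h0
    simp
  · rw [prod_wt hf.1 hf.2 h0, ← card_fiber hf.1 hf.2] at *
    have e : {A : Matrix (Fin n) (Fin n) F //
        (IsUnit A ∧ A.charpoly = minpoly F A) ∧ A.charpoly = f} ≃
        {A : Matrix (Fin n) (Fin n) F // A.charpoly = minpoly F A ∧ A.charpoly = f} :=
      Equiv.subtypeEquivRight fun A => by
        constructor
        · rintro ⟨⟨_, h⟩, h'⟩; exact ⟨h, h'⟩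
        · rintro ⟨h, h'⟩; exact ⟨⟨by rw [isUnit_iff_charpoly, h']; exact h0, h⟩, h'⟩
    rw [Nat.card_congr e]
    push_cast at *
    have h1 := left_ne_zero_of_mul hG
    have h2 := right_ne_zero_of_mul hG
    field_simp

end analytic

/-- The proportion of cyclic matrices (characteristic polynomial equals minimal polynomial)
among invertible `n × n` matrices over a finite field with `q` elements tends to
`(1 − q^{−5})/(1 + q^{−3})` as `n → ∞`. -/
theorem tendsto_cyclicProportion_GL {F : Type} [Field F] [Fintype F] (q : ℕ)
    (hq : Fintype.card F = q) :
    Filter.Tendsto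
      (fun n =>
        (Nat.card {A : Matrix (Fin n) (Fin n) F // IsUnit A ∧ A.charpoly = minpoly F A} : ℝ) /
          (Nat.card {A : Matrix (Fin n) (Fin n) F // IsUnit A} : ℝ))
      Filter.atTop
      (nhds ((1 - ((q : ℝ))⁻¹ ^ 5) / (1 + ((q : ℝ))⁻¹ ^ 3))) := by
  subst hq
  simp_rw [card_cyclic]
  exact tendsto_wt
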